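/- Let E and F be finite-dimensional real inner product spaces with dim E = m ≥ n = dim F ≥ 1, and let Φ : E → F be a Lipschitz map. If p ∈ E is nonsingular for Φ in the sense of Clarke, then there exist constants λ > 0, δ > 0 and ε₀ > 0 such that for every ε ∈ (0, ε₀), every q in the open ball B(p, λ), and every unit vector u ∈ F, there is a unit vector w ∈ E with ⟪(fderiv ℝ Φ_ε q)(w), u⟫ ≥ δ; in particular, for every ε ∈ (0, ε₀) the derivative fderiv ℝ Φ_ε q is surjective at every q ∈ B(p, λ). -/

import Mathlib

open Filter Topology MeasureTheory
open scoped RealInnerProductSpace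

/-- The mixture of the differential of a Lipschitz map `Φ` at `p`: all operator-norm limits
of `fderiv ℝ Φ xᵢ` along sequences of differentiability points `xᵢ → p`. -/
def mixture {E F : Type*} [NormedAddCommGroup E] [NormedSpace ℝ E]
    [NormedAddCommGroup F] [NormedSpace ℝ F] (Φ : E → F) (p : E) :
    Set (E →L[ℝ] F) :=
  {G : E →L[ℝ] F | ∃ x : ℕ → E, (∀ i, DifferentiableAt ℝ Φ (x i)) ∧
    Tendsto x atTop (𝓝 p) ∧ Tendsto (fun i => fderiv ℝ Φ (x i)) atTop (𝓝 G)}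

/-- The Clarke generalized differential of `Φ` at `p`. -/
def clarke {E F : Type*} [NormedAddCommGroup E] [NormedSpace ℝ E]
    [NormedAddCommGroup F] [NormedSpace ℝ F] (Φ : E → F) (p : E) :
    Set (E →L[ℝ] F) :=
  convexHull ℝ (mixture Φ p)

/-- The mollification of `Φ` by the rescaled kernel `ρ_ε(y) = ε^{-m} ρ(ε⁻¹ y)`:
`Φ_ε(q) = ∫ ρ_ε(y) • Φ(q - y) dy`. -/
noncomputable def mollify {m : ℕ} {F : Type*} [NormedAddCommGroup F] [NormedSpace ℝ F]
    (ρ : EuclideanSpace ℝ (Fin m) → ℝ) (ε : ℝ)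
    (Φ : EuclideanSpace ℝ (Fin m) → F) (q : EuclideanSpace ℝ (Fin m)) : F :=
  ∫ y : EuclideanSpace ℝ (Fin m), ((ε ^ m)⁻¹ * ρ (ε⁻¹ • y)) • Φ (q - y)

section ConvexHull

variable {V : Type*} [AddCommGroup V] [Module ℝ V]

/-- Carathéodory's theorem with a fixed number of (possibly repeated) points. -/
lemma exists_stdSimplex_sum_eq_of_mem_convexHull [FiniteDimensional ℝ V] {s : Set V} {x : V}
    (hx : x ∈ convexHull ℝ s) :
    ∃ w ∈ stdSimplex ℝ (Fin (Module.finrank ℝ V + 1)),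
      ∃ z ∈ Set.univ.pi fun _ : Fin (Module.finrank ℝ V + 1) => s, ∑ i, w i • z i = x := by
  obtain ⟨x₀, hx₀⟩ : s.Nonempty := convexHull_nonempty_iff.1 ⟨x, hx⟩
  obtain ⟨ι, _, z, w, hz, hind, hw, hw1, hsum⟩ := eq_pos_convex_span_of_mem_convexHull hx
  have hcard : Fintype.card ι ≤ Fintype.card (Fin (Module.finrank ℝ V + 1)) := by
    simpa using hind.card_le_finrank_succ.trans
      (Nat.add_le_add_right (Submodule.finrank_le _) 1)
  obtain ⟨e⟩ := Function.Embedding.nonempty_of_card_le hcard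
  have hwe (i : ι) : Function.extend e w 0 (e i) = w i := e.injective.extend_apply _ _ _
  have hze (i : ι) : Function.extend e z (fun _ => x₀) (e i) = z i :=
    e.injective.extend_apply _ _ _
  have hw0 (j) (hj : j ∉ Set.range e) : Function.extend e w 0 j = 0 :=
    Function.extend_apply' _ _ _ hj
  refine ⟨Function.extend e w 0, ⟨fun j => ?_, ?_⟩, Function.extend e z fun _ => x₀,
    fun j _ => ?_, ?_⟩
  · by_cases hj : j ∈ Set.range e
    · obtain ⟨i, rfl⟩ := hj
      exact (hwe i).symm ▸ (hw i).le
    · exact (hw0 j hj).ge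
  · rw [← hw1]
    exact (Fintype.sum_of_injective e e.injective _ _ hw0 fun i => (hwe i).symm).symm
  · by_cases hj : j ∈ Set.range e
    · obtain ⟨i, rfl⟩ := hj
      rw [hze]
      exact hz ⟨i, rfl⟩
    · rw [Function.extend_apply' _ _ _ hj]
      exact hx₀
  · rw [← hsum]
    refine (Fintype.sum_of_injective e e.injective _ _ (fun j hj => ?_) fun i => ?_).symm
    · rw [hw0 j hj, zero_smul]
    · rw [hwe, hze]

/-- In finite dimension, the convex hull of a compact set is compact. -/
lemma IsCompact.isCompact_convexHull [FiniteDimensional ℝ V] [TopologicalSpace V]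
    [ContinuousAdd V] [ContinuousSMul ℝ V] {s : Set V} (hs : IsCompact s) :
    IsCompact (convexHull ℝ s) := by
  have hcomp := ((isCompact_stdSimplex ℝ (Fin (Module.finrank ℝ V + 1))).prod
    (isCompact_univ_pi fun _ : Fin (Module.finrank ℝ V + 1) => hs)).image
    (f := fun a => ∑ i, a.1 i • a.2 i) (by fun_prop)
  convert hcomp using 1
  refine Set.Subset.antisymm (fun x hx => ?_) ?_
  · obtain ⟨w, hw, z, hz, h⟩ := exists_stdSimplex_sum_eq_of_mem_convexHull hx
    exact ⟨(w, z), ⟨hw, hz⟩, h⟩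
  · rintro _ ⟨⟨w, z⟩, ⟨hw, hz⟩, rfl⟩
    exact (convex_convexHull ℝ s).sum_mem (fun i _ => hw.1 i) hw.2
      fun i _ => subset_convexHull ℝ s (hz i trivial)

end ConvexHull

section Mixture

variable {E F : Type*} [NormedAddCommGroup E] [NormedSpace ℝ E]
    [NormedAddCommGroup F] [NormedSpace ℝ F] {Φ : E → F} {L : NNReal}

lemma isClosed_mixture (Φ : E → F) (p : E) : IsClosed (mixture Φ p) := by
  have : mixture Φ p = (fun G : E →L[ℝ] F => (p, G)) ⁻¹'
      closure ((fun x => (x, fderiv ℝ Φ x)) '' {x | DifferentiableAt ℝ Φ x}) := by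
    ext G
    rw [Set.mem_preimage, mem_closure_iff_seq_limit]
    constructor
    · rintro ⟨x, hx, hxp, hG⟩
      exact ⟨fun i => (x i, fderiv ℝ Φ (x i)), fun i => ⟨x i, hx i, rfl⟩, hxp.prodMk_nhds hG⟩
    · rintro ⟨y, hy, hlim⟩
      choose x hx hxy using hy
      obtain rfl : (fun i => (x i, fderiv ℝ Φ (x i))) = y := funext hxy
      exact ⟨x, hx, (Prod.tendsto_iff _ _).1 hlim⟩
  rw [this]
  exact isClosed_closure.preimage (by fun_prop)

lemma LipschitzWith.mixture_subset_closedBall (hΦ : LipschitzWith L Φ) (p : E) :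
    mixture Φ p ⊆ Metric.closedBall 0 L := by
  rintro G ⟨x, -, -, hG⟩
  exact Metric.isClosed_closedBall.mem_of_tendsto hG
    (Eventually.of_forall fun i => by simpa using norm_fderiv_le_of_lipschitz ℝ hΦ)

variable [FiniteDimensional ℝ E] [FiniteDimensional ℝ F]

lemma LipschitzWith.isCompact_mixture (hΦ : LipschitzWith L Φ) (p : E) :
    IsCompact (mixture Φ p) :=
  have : ProperSpace (E →L[ℝ] F) := FiniteDimensional.proper ℝ _
  (isCompact_closedBall 0 (L : ℝ)).of_isClosed_subset (isClosed_mixture Φ p)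
    (hΦ.mixture_subset_closedBall p)

lemma LipschitzWith.isCompact_clarke (hΦ : LipschitzWith L Φ) (p : E) :
    IsCompact (clarke Φ p) :=
  (hΦ.isCompact_mixture p).isCompact_convexHull

/-- Near `p`, the differential of a Lipschitz map is close to its mixture at `p`. -/
lemma LipschitzWith.exists_forall_fderiv_mem_thickening_mixture (hΦ : LipschitzWith L Φ) (p : E)
    {η : ℝ} (hη : 0 < η) :
    ∃ r > 0, ∀ x ∈ Metric.ball p r, DifferentiableAt ℝ Φ x →
      fderiv ℝ Φ x ∈ Metric.thickening η (mixture Φ p) := by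
  have : ProperSpace (E →L[ℝ] F) := FiniteDimensional.proper ℝ _
  by_contra! h
  choose x hx hdiff hfar using fun k : ℕ => h (1 / ((k : ℝ) + 1)) Nat.one_div_pos_of_nat
  have hxp : Tendsto x atTop (𝓝 p) := tendsto_iff_dist_tendsto_zero.2 <|
    squeeze_zero (fun _ => dist_nonneg) (fun k => (hx k).le)
      tendsto_one_div_add_atTop_nhds_zero_nat
  obtain ⟨G, -, φ, hφ, hG⟩ := (isCompact_closedBall (0 : E →L[ℝ] F) (L : ℝ)).tendsto_subseq
    (x := fun k => fderiv ℝ Φ (x k)) fun k => by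
      simpa using norm_fderiv_le_of_lipschitz ℝ hΦ
  have hGm : G ∈ mixture Φ p :=
    ⟨x ∘ φ, fun k => hdiff _, hxp.comp hφ.tendsto_atTop, hG⟩
  obtain ⟨k, hk⟩ := (hG.eventually (Metric.isOpen_thickening.mem_nhds
    (Metric.self_subset_thickening hη _ hGm))).exists
  exact hfar (φ k) hk

end Mixture

section Adjoint

variable {E F : Type*} [NormedAddCommGroup E] [InnerProductSpace ℝ E]
    [NormedAddCommGroup F] [InnerProductSpace ℝ F] [CompleteSpace E] [CompleteSpace F]

lemma ContinuousLinearMap.adjoint_apply_ne_zero_of_surjective {g : E →L[ℝ] F}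
    (hg : Function.Surjective g) {u : F} (hu : u ≠ 0) : adjoint g u ≠ 0 := by
  intro h
  obtain ⟨w, rfl⟩ := hg u
  apply hu
  rw [← inner_self_eq_zero (𝕜 := ℝ), ← adjoint_inner_right, h, inner_zero_right]

/-- A compact set of surjective maps has adjoints uniformly bounded below on the unit sphere. -/
lemma IsCompact.exists_forall_le_norm_adjoint_apply [FiniteDimensional ℝ F]
    {C : Set (E →L[ℝ] F)} (hC : IsCompact C) (hsurj : ∀ g ∈ C, Function.Surjective g) :
    ∃ δ > 0, ∀ g ∈ C, ∀ u : F, ‖u‖ = 1 → δ ≤ ‖ContinuousLinearMap.adjoint g u‖ := by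
  have hcont : Continuous fun a : (E →L[ℝ] F) × F => ‖ContinuousLinearMap.adjoint a.1 a.2‖ := by
    fun_prop
  obtain ⟨δ, hδ, h⟩ := (hC.prod (isCompact_sphere (0 : F) 1)).exists_forall_le'
    hcont.continuousOn (a := 0) (by
      rintro ⟨g, u⟩ ⟨hg, hu⟩
      refine norm_pos_iff.2 (ContinuousLinearMap.adjoint_apply_ne_zero_of_surjective
        (hsurj g hg) ?_)
      rintro rfl
      simp at hu)
  exact ⟨δ, hδ, fun g hg u hu => h (g, u) ⟨hg, by simpa using hu⟩⟩

lemma ContinuousLinearMap.exists_unit_le_inner_of_le_norm_adjoint {g : E →L[ℝ] F} {u : F}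
    {δ : ℝ} (hδ : 0 < δ) (h : δ ≤ ‖adjoint g u‖) : ∃ w : E, ‖w‖ = 1 ∧ δ ≤ ⟪g w, u⟫ := by
  have hpos : 0 < ‖adjoint g u‖ := hδ.trans_le h
  refine ⟨‖adjoint g u‖⁻¹ • adjoint g u, ?_, ?_⟩
  · rw [norm_smul, norm_inv, norm_norm, inv_mul_cancel₀ hpos.ne']
  · rw [← adjoint_inner_right, real_inner_smul_left, real_inner_self_eq_norm_sq, sq,
      inv_mul_cancel_left₀ hpos.ne']
    exact h

end Adjoint

lemma ContinuousLinearMap.surjective_of_forall_unit_exists_inner_pos {E F : Type*}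
    [NormedAddCommGroup E] [NormedSpace ℝ E] [NormedAddCommGroup F] [InnerProductSpace ℝ F]
    [FiniteDimensional ℝ F] {g : E →L[ℝ] F} (h : ∀ u : F, ‖u‖ = 1 → ∃ w : E, 0 < ⟪g w, u⟫) :
    Function.Surjective g := by
  rw [← ContinuousLinearMap.coe_coe, ← LinearMap.range_eq_top,
    ← Submodule.orthogonal_eq_bot_iff, Submodule.eq_bot_iff]
  intro v hv
  by_contra hv0
  obtain ⟨w, hw⟩ := h (‖v‖⁻¹ • v) (norm_smul_inv_norm (𝕜 := ℝ) hv0)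
  rw [real_inner_smul_right, (Submodule.mem_orthogonal _ v).1 hv (g w) ⟨w, rfl⟩, mul_zero] at hw
  exact hw.false

section Mollify

variable {m : ℕ} {F : Type*} [NormedAddCommGroup F] [NormedSpace ℝ F] [FiniteDimensional ℝ F]

/-- The convolution of a Lipschitz map with a compactly supported continuous kernel may be
differentiated on the Lipschitz factor. -/
lemma LipschitzWith.hasFDerivAt_integral_smul_comp_sub {E : Type*} [NormedAddCommGroup E]
    [NormedSpace ℝ E] [FiniteDimensional ℝ E] [MeasurableSpace E] [BorelSpace E]
    (μ : Measure E) [μ.IsAddHaarMeasure] {c : E → ℝ} (hc : Continuous c)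
    (hcs : HasCompactSupport c) {L : NNReal} {Φ : E → F} (hΦ : LipschitzWith L Φ) (q : E) :
    Integrable (fun y => c y • fderiv ℝ Φ (q - y)) μ ∧
      HasFDerivAt (fun q => ∫ y, c y • Φ (q - y) ∂μ) (∫ y, c y • fderiv ℝ Φ (q - y) ∂μ) q := by
  have hcont (x : E) : Continuous fun y => c y • Φ (x - y) :=
    hc.smul (hΦ.continuous.comp (by fun_prop))
  have hae : ∀ᵐ y ∂μ, DifferentiableAt ℝ Φ (q - y) :=
    (quasiMeasurePreserving_sub_left μ q).ae hΦ.ae_differentiableAt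
  refine hasFDerivAt_integral_of_dominated_loc_of_lip' (bound := fun y => ‖c y‖ * L) univ_mem
    (fun x _ => (hcont x).aestronglyMeasurable)
    ((hcont q).integrable_of_hasCompactSupport hcs.smul_right) ?_ ?_
    ((hc.integrable_of_hasCompactSupport hcs).norm.mul_const _) ?_
  · borelize (E →L[ℝ] F)
    exact hc.aestronglyMeasurable.smul
      ((measurable_fderiv ℝ Φ).comp (measurable_const.sub measurable_id)).aestronglyMeasurable
  · refine Eventually.of_forall fun y x _ => ?_
    rw [← smul_sub, norm_smul, mul_assoc]
    gcongr
    simpa using hΦ.norm_sub_le (x - y) (q - y)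
  · filter_upwards [hae] with y hy
    exact ((hasFDerivAt_comp_sub y).2 hy.hasFDerivAt).const_smul (c y)

/-- A weighted average, with nonnegative density of total mass one, of points of a closed convex
set lies in that set. -/
lemma Convex.integral_smul_mem {α V : Type*} [MeasurableSpace α] {μ : Measure α}
    [NormedAddCommGroup V] [NormedSpace ℝ V] [CompleteSpace V] {T : Set V} (hT : Convex ℝ T)
    (hTc : IsClosed T) {c : α → ℝ} (hcm : Measurable c) (hc0 : ∀ y, 0 ≤ c y)
    (hc1 : ∫ y, c y ∂μ = 1) {f : α → V} (hf : ∀ᵐ y ∂μ, c y ≠ 0 → f y ∈ T)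
    (hfi : Integrable (fun y => c y • f y) μ) : ∫ y, c y • f y ∂μ ∈ T := by
  have hci : Integrable c μ := integrable_of_integral_eq_one hc1
  have hm : Measurable fun y => ENNReal.ofReal (c y) := hcm.ennreal_ofReal
  have hlt : ∀ᵐ y ∂μ, ENNReal.ofReal (c y) < ⊤ := by simp
  have hprob : IsProbabilityMeasure (μ.withDensity fun y => ENNReal.ofReal (c y)) := by
    refine ⟨?_⟩
    rw [withDensity_apply _ MeasurableSet.univ, Measure.restrict_univ,
      ← ofReal_integral_eq_lintegral_ofReal hci (Eventually.of_forall hc0), hc1,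
      ENNReal.ofReal_one]
  have heq := integral_withDensity_eq_integral_toReal_smul hm hlt f
  simp only [ENNReal.toReal_ofReal (hc0 _)] at heq
  rw [← heq]
  refine hT.integral_mem hTc ?_ ?_
  · rw [ae_withDensity_iff hm]
    filter_upwards [hf] with y hy hne
    exact hy fun h => hne (by simp [h])
  · rw [integrable_withDensity_iff_integrable_smul' hm hlt]
    simpa only [ENNReal.toReal_ofReal (hc0 _)] using hfi

variable {ρ : EuclideanSpace ℝ (Fin m) → ℝ} {Φ : EuclideanSpace ℝ (Fin m) → F} {L : NNReal}

/-- The differential of the mollification at `q` lies in every closed convex set containing the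
differentials of `Φ` at the differentiability points of `closedBall q ε`. -/
lemma fderiv_mollify_mem_of_convex (hρ_cont : Continuous ρ) (hρ_nonneg : ∀ y, 0 ≤ ρ y)
    (hρ_supp : Function.support ρ ⊆ Metric.closedBall 0 1) (hρ_int : ∫ y, ρ y = 1)
    (hΦ : LipschitzWith L Φ) {ε : ℝ} (hε : 0 < ε) {q : EuclideanSpace ℝ (Fin m)}
    {T : Set (EuclideanSpace ℝ (Fin m) →L[ℝ] F)} (hT : Convex ℝ T) (hTc : IsClosed T)
    (h : ∀ x ∈ Metric.closedBall q ε, DifferentiableAt ℝ Φ x → fderiv ℝ Φ x ∈ T) :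
    fderiv ℝ (mollify ρ ε Φ) q ∈ T := by
  set c : EuclideanSpace ℝ (Fin m) → ℝ := fun y => (ε ^ m)⁻¹ * ρ (ε⁻¹ • y) with hc_def
  have hc : Continuous c := by fun_prop
  have hc_supp (y) (hy : c y ≠ 0) : ‖y‖ ≤ ε := by
    have := hρ_supp (right_ne_zero_of_mul hy)
    rwa [mem_closedBall_zero_iff, norm_smul, norm_inv, Real.norm_of_nonneg hε.le,
      inv_mul_le_one₀ hε] at this
  have hcs : HasCompactSupport c :=
    HasCompactSupport.of_support_subset_isCompact (isCompact_closedBall 0 ε)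
      fun y hy => by simpa using hc_supp y hy
  have hc1 : ∫ y, c y = 1 := by
    rw [hc_def, integral_const_mul, Measure.integral_comp_inv_smul, hρ_int, finrank_euclideanSpace,
      Fintype.card_fin, abs_of_pos (pow_pos hε m), smul_eq_mul, mul_one,
      inv_mul_cancel₀ (pow_pos hε m).ne']
  obtain ⟨hint, hderiv⟩ := hΦ.hasFDerivAt_integral_smul_comp_sub volume hc hcs q
  have : fderiv ℝ (mollify ρ ε Φ) q = ∫ y, c y • fderiv ℝ Φ (q - y) := hderiv.fderiv
  rw [this]
  refine hT.integral_smul_mem hTc hc.measurable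
    (fun y => mul_nonneg (by positivity) (hρ_nonneg _)) hc1 ?_ hint
  filter_upwards [(quasiMeasurePreserving_sub_left volume q).ae
    hΦ.ae_differentiableAt] with y hy hcy
  exact h _ (by simpa using hc_supp y hcy) hy

end Mollify

theorem stmt_14 {m n : ℕ} (hn : 1 ≤ n) (hmn : n ≤ m)
    (ρ : EuclideanSpace ℝ (Fin m) → ℝ)
    (hρ_smooth : ContDiff ℝ (⊤ : ℕ∞) ρ) (hρ_nonneg : ∀ y, 0 ≤ ρ y)
    (hρ_supp : Function.support ρ ⊆ Metric.closedBall 0 1)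
    (hρ_int : ∫ y : EuclideanSpace ℝ (Fin m), ρ y = 1)
    (Φ : EuclideanSpace ℝ (Fin m) → EuclideanSpace ℝ (Fin n))
    (L : NNReal) (hΦ : LipschitzWith L Φ) (p : EuclideanSpace ℝ (Fin m))
    (hp : ∀ g ∈ clarke Φ p,
      Module.finrank ℝ (LinearMap.range (g : EuclideanSpace ℝ (Fin m) →ₗ[ℝ]
        EuclideanSpace ℝ (Fin n))) = min m n) :
    ∃ lam > (0 : ℝ), ∃ δ > (0 : ℝ), ∃ ε₀ > (0 : ℝ), ∀ ε : ℝ, 0 < ε → ε < ε₀ →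
      ∀ q ∈ Metric.ball p lam,
        (∀ u : EuclideanSpace ℝ (Fin n), ‖u‖ = 1 →
          ∃ w : EuclideanSpace ℝ (Fin m), ‖w‖ = 1 ∧
            δ ≤ ⟪fderiv ℝ (mollify ρ ε Φ) q w, u⟫) ∧
        Function.Surjective (fderiv ℝ (mollify ρ ε Φ) q) := by
  have hsurj : ∀ g ∈ clarke Φ p, Function.Surjective g := fun g hg => by
    rw [← ContinuousLinearMap.coe_coe, ← LinearMap.range_eq_top]
    apply Submodule.eq_top_of_finrank_eq
    rw [hp g hg, min_eq_right hmn, finrank_euclideanSpace, Fintype.card_fin]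
  have hcpt : IsCompact (clarke Φ p) := hΦ.isCompact_clarke p
  obtain ⟨δ, hδ, hC⟩ := hcpt.exists_forall_le_norm_adjoint_apply hsurj
  obtain ⟨r, hr, hball⟩ :=
    hΦ.exists_forall_fderiv_mem_thickening_mixture p (half_pos hδ)
  refine ⟨r / 2, half_pos hr, δ / 2, half_pos hδ, r / 2, half_pos hr, fun ε hε hεr q hq => ?_⟩
  have hmem : fderiv ℝ (mollify ρ ε Φ) q ∈ Metric.cthickening (δ / 2) (clarke Φ p) := by
    refine fderiv_mollify_mem_of_convex hρ_smooth.continuous hρ_nonneg hρ_supp hρ_int hΦ hε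
      ((convex_convexHull ℝ _).cthickening _) Metric.isClosed_cthickening fun x hx hdiff => ?_
    refine Metric.thickening_subset_cthickening _ _
      (Metric.thickening_subset_of_subset _ (subset_convexHull ℝ _) (hball x ?_ hdiff))
    rw [Metric.mem_ball] at hq ⊢
    rw [Metric.mem_closedBall] at hx
    linarith [dist_triangle x q p]
  rw [hcpt.cthickening_eq_biUnion_closedBall (half_pos hδ).le] at hmem
  obtain ⟨g, hg, hdist⟩ := Set.mem_iUnion₂.1 hmem
  set D := fderiv ℝ (mollify ρ ε Φ) q
  have hlower (u : EuclideanSpace ℝ (Fin n)) (hu : ‖u‖ = 1) :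
      δ / 2 ≤ ‖ContinuousLinearMap.adjoint D u‖ := by
    have h1 : ‖ContinuousLinearMap.adjoint g u - ContinuousLinearMap.adjoint D u‖ ≤ δ / 2 := by
      rw [← sub_apply, ← map_sub]
      refine (ContinuousLinearMap.le_opNorm _ _).trans ?_
      rw [hu, mul_one, LinearIsometryEquiv.norm_map, norm_sub_rev, ← dist_eq_norm]
      exact hdist
    linarith [hC g hg u hu, norm_le_norm_add_norm_sub' (ContinuousLinearMap.adjoint g u)
      (ContinuousLinearMap.adjoint D u)]
  have hunit (u : EuclideanSpace ℝ (Fin n)) (hu : ‖u‖ = 1) :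
      ∃ w : EuclideanSpace ℝ (Fin m), ‖w‖ = 1 ∧ δ / 2 ≤ ⟪D w, u⟫ :=
    ContinuousLinearMap.exists_unit_le_inner_of_le_norm_adjoint (half_pos hδ) (hlower u hu)
  refine ⟨hunit, ContinuousLinearMap.surjective_of_forall_unit_exists_inner_pos fun u hu => ?_⟩
  obtain ⟨w, -, hw⟩ := hunit u hu
  exact ⟨w, (half_pos hδ).trans_le hw⟩
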